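/- arXiv:2212.01943 — 6 statements merged into one kernel-verified Lean document; each statement's English description precedes it below -/
import Mathlib

section
/- Let Y = (Y_1,…,Y_n) with Y_i ~ Poisson(μ_i) independently, and let Ỹ be an independent copy of Y. Let g : ℤ_+^n → ℝ_+^n be measurable and let D_φ be a Bregman divergence with generator φ. If E[φ(Ỹ)], E[φ(g(Y))], E[⟨∇φ(g(Y)), Ỹ − g(Y)⟩], and E[⟨∇φ(g(Y)), μ − g(Y)⟩] are all finite, then Err(g) − Risk(g) = E[φ(Y)] − φ(μ), where Err(g) = E[D_φ(Ỹ, g(Y))] and Risk(g) = E[D_φ(μ, g(Y))]. In particular, since E[φ(Y)] − φ(μ) ≥ 0 by Jensen's inequality, Err(g) ≥ Risk(g). -/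
open MeasureTheory ProbabilityTheory Filter Set

noncomputable section

/-- Euclidean inner product on `ℝ^n`. -/
def dotR {n : ℕ} (u v : Fin n → ℝ) : ℝ := ∑ i, u i * v i

/-- Bregman divergence `D_φ(a,b) = φ(a) - φ(b) - ⟨∇φ(b), a - b⟩`, with gradient `φ'`. -/
def breg {n : ℕ} (φ : (Fin n → ℝ) → ℝ) (φ' : (Fin n → ℝ) → Fin n → ℝ)
    (a b : Fin n → ℝ) : ℝ :=
  φ a - φ b - dotR (φ' b) (fun i => a i - b i)

/-- Coercion of a nonnegative-integer vector to a real vector. -/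
def toR {n : ℕ} (y : Fin n → ℕ) : Fin n → ℝ := fun i => (y i : ℝ)

/-- `φ` is differentiable everywhere with gradient `φ'`. -/
def HasGrad {n : ℕ} (φ : (Fin n → ℝ) → ℝ) (φ' : (Fin n → ℝ) → Fin n → ℝ) : Prop :=
  ∀ x, HasFDerivAt φ (∑ i, φ' x i • (ContinuousLinearMap.proj i : (Fin n → ℝ) →L[ℝ] ℝ)) x

/-- Joint pmf of `n` independent Poisson coordinates with mean vector `ν`. -/
def poisPMF {n : ℕ} (ν : Fin n → ℝ) (y : Fin n → ℕ) : ℝ :=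
  ∏ i, Real.exp (-ν i) * ν i ^ y i / Nat.factorial (y i)

/-- `Y ~ Pois(ν)`: the coordinates of `Y` are independent Poissons with means `ν i`. -/
def HasPoissonLaw {Ω : Type*} [MeasurableSpace Ω] {n : ℕ} (P : Measure Ω)
    (ν : Fin n → ℝ) (Y : Ω → Fin n → ℕ) : Prop :=
  ∀ y, P {ω | Y ω = y} = ENNReal.ofReal (poisPMF ν y)

/-- Independence of two discrete random vectors, via factorization of the joint pmf. -/
def IndepDiscrete {Ω : Type*} [MeasurableSpace Ω] {n : ℕ} (P : Measure Ω)
    (Y Z : Ω → Fin n → ℕ) : Prop :=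
  ∀ y z, P {ω | Y ω = y ∧ Z ω = z} = P {ω | Y ω = y} * P {ω | Z ω = z}

/-- Binomial(m, p) pmf at `k`. -/
def binomPMF (m k : ℕ) (p : ℝ) : ℝ := (m.choose k : ℝ) * p ^ k * (1 - p) ^ (m - k)

/-- Joint pmf of independent binomials `ω_i ~ Binom(y_i, p)`. -/
def binomJointPMF {n : ℕ} (y : Fin n → ℕ) (p : ℝ) (w : Fin n → ℕ) : ℝ :=
  ∏ i, binomPMF (y i) (w i) p


lemma hasSum_poisson_mean (r : NNReal) :
    HasSum (fun k : ℕ => Real.exp (-r) * (r : ℝ) ^ k / Nat.factorial k * k) r := by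
  rw [← hasSum_nat_add_iff' 1]
  have h := (hasSum_one_poissonMeasure r).mul_left (r : ℝ)
  simp only [mul_one] at h
  simp only [Finset.range_one, Finset.sum_singleton, Nat.cast_zero, mul_zero, sub_zero]
  convert! h using 2 with k
  rw [Nat.factorial_succ]
  push_cast
  field_simp
  ring

lemma integrable_natCast_poissonMeasure (r : NNReal) :
    Integrable (fun k : ℕ => (k : ℝ)) (poissonMeasure r) := by
  rw [integrable_poissonMeasure_iff]
  simpa using (hasSum_poisson_mean r).summable

lemma integral_natCast_poissonMeasure (r : NNReal) :
    ∫ k : ℕ, (k : ℝ) ∂(poissonMeasure r) = r := by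
  rw [integral_poissonMeasure]
  simpa using (hasSum_poisson_mean r).tsum_eq

section

variable {n : ℕ} {Ω : Type*} [MeasurableSpace Ω] {P : Measure Ω} {ν : Fin n → ℝ}
  {Y Z : Ω → Fin n → ℕ}

lemma HasPoissonLaw.map_eq (hν : ∀ i, 0 ≤ ν i) (hYm : Measurable Y) (hY : HasPoissonLaw P ν Y) :
    P.map Y = Measure.pi fun i => poissonMeasure (ν i).toNNReal := by
  refine Measure.ext_of_singleton fun y => ?_
  rw [Measure.map_apply hYm (measurableSet_singleton y), Measure.pi_singleton]
  simp only [poissonMeasure_singleton, Real.coe_toNNReal _ (hν _)]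
  rw [← ENNReal.ofReal_prod_of_nonneg fun i _ => by have := hν i; positivity]
  exact hY y

lemma HasPoissonLaw.map_eval (hν : ∀ i, 0 ≤ ν i) (hYm : Measurable Y)
    (hY : HasPoissonLaw P ν Y) (i : Fin n) :
    P.map (fun ω => Y ω i) = poissonMeasure (ν i).toNNReal := by
  rw [← (measurePreserving_eval (fun i => poissonMeasure (ν i).toNNReal) i).map_eq,
    ← hY.map_eq hν hYm, Measure.map_map (measurable_pi_apply i) hYm]
  rfl

lemma HasPoissonLaw.integrable_coord (hν : ∀ i, 0 ≤ ν i) (hYm : Measurable Y)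
    (hY : HasPoissonLaw P ν Y) (i : Fin n) : Integrable (fun ω => (Y ω i : ℝ)) P := by
  have h := integrable_natCast_poissonMeasure (ν i).toNNReal
  rw [← hY.map_eval hν hYm i] at h
  exact h.comp_measurable (by fun_prop)

lemma HasPoissonLaw.integral_coord (hν : ∀ i, 0 ≤ ν i) (hYm : Measurable Y)
    (hY : HasPoissonLaw P ν Y) (i : Fin n) : ∫ ω, (Y ω i : ℝ) ∂P = ν i := by
  have h := integral_natCast_poissonMeasure (ν i).toNNReal
  rw [← hY.map_eval hν hYm i, integral_map (by fun_prop) .of_discrete,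
    Real.coe_toNNReal _ (hν i)] at h
  exact h

lemma HasPoissonLaw.integral_dotR [IsProbabilityMeasure P] (hν : ∀ i, 0 ≤ ν i)
    (hYm : Measurable Y) (hY : HasPoissonLaw P ν Y) (u v : Fin n → ℝ) :
    ∫ ω, dotR u (fun i => (Y ω i : ℝ) - v i) ∂P = dotR u (fun i => ν i - v i) := by
  have hi := hY.integrable_coord hν hYm
  have hsub (i) : Integrable (fun ω => (Y ω i : ℝ) - v i) P := (hi i).sub (integrable_const _)
  simp only [dotR]
  rw [integral_finsetSum _ fun i _ => (hsub i).const_mul _]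
  refine Finset.sum_congr rfl fun i _ => ?_
  rw [integral_const_mul, integral_sub (hi i) (integrable_const _), hY.integral_coord hν hYm]
  simp

lemma IndepDiscrete.map_prodMk [IsProbabilityMeasure P] (hYm : Measurable Y) (hZm : Measurable Z)
    (h : IndepDiscrete P Y Z) :
    P.map (fun ω => (Y ω, Z ω)) = (P.map Y).prod (P.map Z) := by
  have := Measure.isProbabilityMeasure_map (μ := P) hYm.aemeasurable
  have := Measure.isProbabilityMeasure_map (μ := P) hZm.aemeasurable
  refine Measure.ext_of_singleton fun ⟨y, z⟩ => ?_
  rw [← Set.singleton_prod_singleton, Measure.prod_prod,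
    Measure.map_apply (hYm.prodMk hZm)
      ((measurableSet_singleton y).prod (measurableSet_singleton z)),
    Measure.map_apply hYm (measurableSet_singleton y),
    Measure.map_apply hZm (measurableSet_singleton z)]
  exact h y z

lemma IndepDiscrete.integral_eq [IsProbabilityMeasure P] (hYm : Measurable Y) (hZm : Measurable Z)
    (h : IndepDiscrete P Y Z) (F : (Fin n → ℕ) → (Fin n → ℕ) → ℝ)
    (hF : Integrable (fun ω => F (Y ω) (Z ω)) P) :
    ∫ ω, F (Y ω) (Z ω) ∂P = ∫ ω, ∫ ω', F (Y ω) (Z ω') ∂P ∂P := by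
  have := Measure.isProbabilityMeasure_map (μ := P) hYm.aemeasurable
  have := Measure.isProbabilityMeasure_map (μ := P) hZm.aemeasurable
  have hm := (hYm.prodMk hZm).aemeasurable (μ := P)
  have hF' : Integrable (Function.uncurry F) ((P.map Y).prod (P.map Z)) := by
    rw [← h.map_prodMk hYm hZm, integrable_map_measure .of_discrete hm]
    exact hF
  have h1 := integral_prod _ hF'
  rw [← h.map_prodMk hYm hZm, integral_map hm .of_discrete,
    integral_map hYm.aemeasurable .of_discrete] at h1
  refine h1.trans (integral_congr_ae (.of_forall fun ω => ?_))
  exact integral_map hZm.aemeasurable .of_discrete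

lemma integral_breg {φ : (Fin n → ℝ) → ℝ} {φ' : (Fin n → ℝ) → Fin n → ℝ}
    {X G : Ω → Fin n → ℝ} (hX : Integrable (fun ω => φ (X ω)) P)
    (hG : Integrable (fun ω => φ (G ω)) P)
    (hdot : Integrable (fun ω => dotR (φ' (G ω)) (fun i => X ω i - G ω i)) P) :
    ∫ ω, breg φ φ' (X ω) (G ω) ∂P = (∫ ω, φ (X ω) ∂P) - (∫ ω, φ (G ω) ∂P)
      - ∫ ω, dotR (φ' (G ω)) (fun i => X ω i - G ω i) ∂P := by
  have hsub : Integrable (fun ω => φ (X ω) - φ (G ω)) P := hX.sub hG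
  rw [← integral_sub hX hG, ← integral_sub hsub hdot]
  rfl

/-- Jensen's inequality for a Poisson vector. -/
lemma HasPoissonLaw.le_integral_of_convexOn [IsProbabilityMeasure P] (hν : ∀ i, 0 ≤ ν i)
    (hYm : Measurable Y) (hY : HasPoissonLaw P ν Y) {φ : (Fin n → ℝ) → ℝ}
    (hconv : ConvexOn ℝ Set.univ φ) (hcont : Continuous φ)
    (hφ : Integrable (fun ω => φ (toR (Y ω))) P) :
    φ ν ≤ ∫ ω, φ (toR (Y ω)) ∂P := by
  have hi : ∀ i, Integrable (fun ω => toR (Y ω) i) P := hY.integrable_coord hν hYm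
  have hmean : ∫ ω, toR (Y ω) ∂P = ν := by
    ext i
    rw [eval_integral hi]
    exact hY.integral_coord hν hYm i
  rw [← hmean]
  exact hconv.map_integral_le hcont.continuousOn isClosed_univ (by simp) (.of_eval hi) hφ

end

/-- for `Y, Ỹ ~ Pois(μ)` independent and a Bregman divergence `D_φ`,
`Err(g) - Risk(g) = E[φ(Ỹ)] - φ(μ)`, and in particular `Err(g) ≥ Risk(g)`. -/
theorem stmt0 {n : ℕ} {Ω : Type*} [MeasurableSpace Ω] (P : Measure Ω) [IsProbabilityMeasure P]
    (μ : Fin n → ℝ) (hμ : ∀ i, 0 ≤ μ i)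
    (Y Yt : Ω → Fin n → ℕ) (hYm : Measurable Y) (hYtm : Measurable Yt)
    (hY : HasPoissonLaw P μ Y) (hYt : HasPoissonLaw P μ Yt)
    (hind : IndepDiscrete P Y Yt)
    (g : (Fin n → ℕ) → Fin n → ℝ) (hg : ∀ y i, 0 ≤ g y i)
    (φ : (Fin n → ℝ) → ℝ) (φ' : (Fin n → ℝ) → Fin n → ℝ)
    (hconv : ConvexOn ℝ Set.univ φ) (hgrad : HasGrad φ φ')
    (h1 : Integrable (fun ω => φ (toR (Yt ω))) P)
    (h2 : Integrable (fun ω => φ (g (Y ω))) P)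
    (h3 : Integrable (fun ω => dotR (φ' (g (Y ω))) (fun i => (Yt ω i : ℝ) - g (Y ω) i)) P)
    (h4 : Integrable (fun ω => dotR (φ' (g (Y ω))) (fun i => μ i - g (Y ω) i)) P) :
    (∫ ω, breg φ φ' (toR (Yt ω)) (g (Y ω)) ∂P) - (∫ ω, breg φ φ' μ (g (Y ω)) ∂P)
        = (∫ ω, φ (toR (Yt ω)) ∂P) - φ μ ∧
      (∫ ω, breg φ φ' μ (g (Y ω)) ∂P) ≤ ∫ ω, breg φ φ' (toR (Yt ω)) (g (Y ω)) ∂P := by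
  have hdot : ∫ ω, dotR (φ' (g (Y ω))) (fun i => (Yt ω i : ℝ) - g (Y ω) i) ∂P
      = ∫ ω, dotR (φ' (g (Y ω))) (fun i => μ i - g (Y ω) i) ∂P := by
    rw [hind.integral_eq hYm hYtm
      (fun y z => dotR (φ' (g y)) (fun i => (z i : ℝ) - g y i)) h3]
    simp only [hYt.integral_dotR hμ hYtm]
  have herr := integral_breg (P := P) h1 h2 h3
  have hrisk := integral_breg (P := P) (X := fun _ => μ) (integrable_const _) h2 h4
  have hconst : ∫ _ω, φ μ ∂P = φ μ := by simp
  have hcont : Continuous φ :=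
    continuous_iff_continuousAt.2 fun x => (hgrad x).continuousAt
  have hjensen := hYt.le_integral_of_convexOn hμ hYtm hconv hcont h1
  simp only [toR] at *
  constructor <;> linarith
end
end

section
/- Let Y ~ Pois(μ) with independent copy Ỹ. Let g : ℤ_+^n → ℝ^n be any function and D_φ any Bregman divergence such that E|φ(g(Y))| < ∞ and E|∇_iφ(g(Y))| < ∞ for i = 1,…,n, and such that all expectations below are finite. Then UE(g) = D_φ(Y, g(Y)) + ⟨∇φ(g(Y)), Y⟩ − ⟨∇φ(g_−(Y)), Y⟩ satisfies E[UE(g)] = E[D_φ(Ỹ, g(Y))], i.e., UE(g) is an unbiased estimator of the test error Err(g). -/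
open MeasureTheory ProbabilityTheory Filter Set

noncomputable section

lemma succ_mul_poisPMF_add_single {n : ℕ} (ν : Fin n → ℝ) (y : Fin n → ℕ) (i : Fin n) :
    ((y i + 1 : ℕ) : ℝ) * poisPMF ν (y + Pi.single i 1) = ν i * poisPMF ν y := by
  unfold poisPMF
  rw [← Finset.mul_prod_erase _ _ (Finset.mem_univ i),
    ← Finset.mul_prod_erase _ (fun j => Real.exp (-ν j) * ν j ^ y j / Nat.factorial (y j))
      (Finset.mem_univ i)]
  have hprod : ∏ j ∈ Finset.univ.erase i, Real.exp (-ν j) * ν j ^ (y + Pi.single i 1 : Fin n → ℕ) j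
        / Nat.factorial ((y + Pi.single i 1 : Fin n → ℕ) j)
      = ∏ j ∈ Finset.univ.erase i, Real.exp (-ν j) * ν j ^ y j / Nat.factorial (y j) := by
    refine Finset.prod_congr rfl fun j hj => ?_
    simp [Pi.single_eq_of_ne (Finset.ne_of_mem_erase hj)]
  rw [hprod, ← mul_assoc, ← mul_assoc]
  congr 1
  simp only [Pi.add_apply, Pi.single_eq_same, Nat.factorial_succ, Nat.cast_mul, pow_succ]
  have h1 : ((y i + 1 : ℕ) : ℝ) ≠ 0 := by positivity
  have h2 : (Nat.factorial (y i) : ℝ) ≠ 0 := by positivity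
  field_simp

section PoissonLaw

variable {Ω : Type*} [MeasurableSpace Ω] {n : ℕ} {P : Measure Ω} {ν : Fin n → ℝ}
  {Y Z : Ω → Fin n → ℕ}

lemma HasPoissonLaw.map_singleton (hY : HasPoissonLaw P ν Y) (hYm : Measurable Y)
    (y : Fin n → ℕ) : P.map Y {y} = ENNReal.ofReal (poisPMF ν y) := by
  rw [Measure.map_apply hYm (measurableSet_singleton y), ← hY y]
  rfl

lemma HasPoissonLaw.map_eq_s4 (hY : HasPoissonLaw P ν Y) (hYm : Measurable Y)
    (hZ : HasPoissonLaw P ν Z) (hZm : Measurable Z) : P.map Y = P.map Z :=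
  Measure.ext_of_singleton fun y => by rw [hY.map_singleton hYm, hZ.map_singleton hZm]

/-- Size-biasing a coordinate of a Poisson vector shifts that coordinate by one. -/
lemma HasPoissonLaw.withDensity_eq (hν : ∀ i, 0 ≤ ν i) (hY : HasPoissonLaw P ν Y)
    (hYm : Measurable Y) (i : Fin n) :
    (P.map Y).withDensity (fun y => ((y i : NNReal) : ENNReal))
      = ENNReal.ofReal (ν i) • (P.map Y).map (fun y => y + Pi.single i 1) := by
  refine Measure.ext_of_singleton fun y => ?_
  rw [withDensity_apply _ (measurableSet_singleton y), lintegral_singleton, Measure.smul_apply,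
    Measure.map_apply (μ := P.map Y) .of_discrete (measurableSet_singleton y),
    hY.map_singleton hYm, smul_eq_mul]
  by_cases hy : y i = 0
  · have hempty : (fun z : Fin n → ℕ => z + Pi.single i 1) ⁻¹' {y} = ∅ := by
      ext z
      simp only [mem_preimage, mem_singleton_iff, mem_empty_iff_false, iff_false]
      rintro rfl
      simp at hy
    simp [hempty, hy]
  · obtain ⟨z, rfl⟩ : ∃ z : Fin n → ℕ, y = z + Pi.single i 1 := by
      refine ⟨y - Pi.single i 1, (tsub_add_cancel_of_le ?_).symm⟩
      intro j
      rcases eq_or_ne j i with rfl | hj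
      · simpa using Nat.one_le_iff_ne_zero.mpr hy
      · simp [Pi.single_eq_of_ne hj]
    have hpre : (fun z : Fin n → ℕ => z + Pi.single i 1) ⁻¹' {z + Pi.single i 1} = {z} := by
      ext w
      simp
    rw [hpre, hY.map_singleton hYm, ← ENNReal.ofReal_mul (hν i),
      ← succ_mul_poisPMF_add_single, ENNReal.ofReal_mul (by positivity),
      ENNReal.ofReal_natCast]
    simp

lemma HasPoissonLaw.integrable_and_integral_mul_sub_single (hν : ∀ i, 0 ≤ ν i)
    (hY : HasPoissonLaw P ν Y) (hYm : Measurable Y) (i : Fin n) {f : (Fin n → ℕ) → ℝ}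
    (hf : Integrable (fun ω => f (Y ω)) P) :
    Integrable (fun ω => (Y ω i : ℝ) * f (Y ω - Pi.single i 1)) P ∧
      ∫ ω, (Y ω i : ℝ) * f (Y ω - Pi.single i 1) ∂P = ν i * ∫ ω, f (Y ω) ∂P := by
  have hfm : Integrable f (P.map Y) :=
    (integrable_map_measure Measurable.of_discrete.aestronglyMeasurable hYm.aemeasurable).mpr hf
  have hshift : Integrable (fun y => f (y - Pi.single i 1))
      ((P.map Y).map fun y => y + Pi.single i 1) := by
    rw [integrable_map_measure Measurable.of_discrete.aestronglyMeasurable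
      Measurable.of_discrete.aemeasurable]
    simpa [Function.comp_def] using hfm
  have hd : Measurable fun y : Fin n → ℕ => (y i : NNReal) := .of_discrete
  constructor
  · have h := hshift.smul_measure (c := ENNReal.ofReal (ν i)) ENNReal.ofReal_ne_top
    rw [← hY.withDensity_eq hν hYm i, integrable_withDensity_iff_integrable_smul hd,
      integrable_map_measure Measurable.of_discrete.aestronglyMeasurable hYm.aemeasurable] at h
    simpa [Function.comp_def, NNReal.smul_def] using h
  · have h := integral_withDensity_eq_integral_smul (μ := P.map Y) hd
      (fun y => f (y - Pi.single i 1))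
    rw [hY.withDensity_eq hν hYm i, integral_smul_measure,
      integral_map Measurable.of_discrete.aemeasurable
        Measurable.of_discrete.aestronglyMeasurable,
      integral_map hYm.aemeasurable Measurable.of_discrete.aestronglyMeasurable,
      integral_map hYm.aemeasurable Measurable.of_discrete.aestronglyMeasurable] at h
    simpa [NNReal.smul_def, ENNReal.toReal_ofReal (hν i)] using h.symm

lemma HasPoissonLaw.integrable_and_integral_apply [IsProbabilityMeasure P] (hν : ∀ i, 0 ≤ ν i)
    (hY : HasPoissonLaw P ν Y) (hYm : Measurable Y) (i : Fin n) :
    Integrable (fun ω => (Y ω i : ℝ)) P ∧ ∫ ω, (Y ω i : ℝ) ∂P = ν i := by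
  simpa using hY.integrable_and_integral_mul_sub_single hν hYm i (f := fun _ => 1)
    (integrable_const 1)

lemma IndepDiscrete.indepFun [IsProbabilityMeasure P] (h : IndepDiscrete P Y Z)
    (hYm : Measurable Y) (hZm : Measurable Z) : IndepFun Y Z P := by
  rw [indepFun_iff_map_prod_eq_prod_map_map hYm.aemeasurable hZm.aemeasurable]
  refine Measure.ext_of_singleton fun ⟨y, z⟩ => ?_
  rw [← singleton_prod_singleton, Measure.prod_prod,
    Measure.map_apply (hYm.prodMk hZm)
      ((measurableSet_singleton y).prod (measurableSet_singleton z)),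
    Measure.map_apply hYm (measurableSet_singleton y),
    Measure.map_apply hZm (measurableSet_singleton z)]
  exact h y z

end PoissonLaw

/-- the estimator `UE(g) = D_φ(Y, g(Y)) + ⟨∇φ(g(Y)), Y⟩ - Σ_i Y_i ∇_iφ(g(Y - e_i))`
is unbiased for the test error `Err(g) = E[D_φ(Ỹ, g(Y))]` in the Poisson means problem. -/
theorem stmt4 {n : ℕ} {Ω : Type*} [MeasurableSpace Ω] (P : Measure Ω) [IsProbabilityMeasure P]
    (μ : Fin n → ℝ) (hμ : ∀ i, 0 ≤ μ i)
    (Y Yt : Ω → Fin n → ℕ) (hYm : Measurable Y) (hYtm : Measurable Yt)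
    (hY : HasPoissonLaw P μ Y) (hYt : HasPoissonLaw P μ Yt)
    (hind : IndepDiscrete P Y Yt)
    (g : (Fin n → ℕ) → Fin n → ℝ)
    (φ : (Fin n → ℝ) → ℝ) (φ' : (Fin n → ℝ) → Fin n → ℝ)
    (hconv : ConvexOn ℝ Set.univ φ) (hgrad : HasGrad φ φ')
    (hφg : Integrable (fun ω => φ (g (Y ω))) P)
    (hφ'g : ∀ i, Integrable (fun ω => φ' (g (Y ω)) i) P)
    (hφY : Integrable (fun ω => φ (toR (Y ω))) P)
    (hφYt : Integrable (fun ω => φ (toR (Yt ω))) P)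
    (h1 : Integrable (fun ω => breg φ φ' (toR (Y ω)) (g (Y ω))) P)
    (h2 : Integrable (fun ω => dotR (φ' (g (Y ω))) (toR (Y ω))) P)
    (h3 : Integrable (fun ω => ∑ i, (Y ω i : ℝ) * φ' (g (Y ω - Pi.single i 1)) i) P)
    (h4 : Integrable (fun ω => breg φ φ' (toR (Yt ω)) (g (Y ω))) P)
    (h5 : Integrable (fun ω => dotR (φ' (g (Y ω))) (toR (Yt ω))) P) :
    (∫ ω, (breg φ φ' (toR (Y ω)) (g (Y ω)) + dotR (φ' (g (Y ω))) (toR (Y ω))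
        - ∑ i, (Y ω i : ℝ) * φ' (g (Y ω - Pi.single i 1)) i) ∂P)
      = ∫ ω, breg φ φ' (toR (Yt ω)) (g (Y ω)) ∂P := by
  have hcross := fun i =>
    hY.integrable_and_integral_mul_sub_single hμ hYm i (f := fun y => φ' (g y) i) (hφ'g i)
  have hmean := fun i => hYt.integrable_and_integral_apply hμ hYtm i
  have hindep : ∀ i, IndepFun (fun ω => φ' (g (Y ω)) i) (fun ω => (Yt ω i : ℝ)) P := fun i =>
    (hind.indepFun hYm hYtm).comp (φ := fun y => φ' (g y) i)
      (ψ := fun y : Fin n → ℕ => (y i : ℝ)) .of_discrete .of_discrete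
  have hprod : ∀ i, Integrable (fun ω => φ' (g (Y ω)) i * (Yt ω i : ℝ)) P := fun i =>
    (hindep i).integrable_mul (hφ'g i) (hmean i).1
  have hinner : ∫ ω, dotR (φ' (g (Y ω))) (toR (Yt ω)) ∂P
      = ∫ ω, ∑ i, (Y ω i : ℝ) * φ' (g (Y ω - Pi.single i 1)) i ∂P := by
    unfold dotR toR
    rw [integral_finsetSum _ fun i _ => hprod i, integral_finsetSum _ fun i _ => (hcross i).1]
    refine Finset.sum_congr rfl fun i _ => ?_
    rw [(hcross i).2, mul_comm (μ i), ← (hmean i).2]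
    exact (hindep i).integral_mul_eq_mul_integral (hφ'g i).1 (hmean i).1.1
  have hφ : ∫ ω, φ (toR (Y ω)) ∂P = ∫ ω, φ (toR (Yt ω)) ∂P := by
    have h := hY.map_eq_s4 hYm hYt hYtm
    rw [← integral_map hYm.aemeasurable (f := fun y => φ (toR y))
        Measurable.of_discrete.aestronglyMeasurable, h,
      integral_map hYtm.aemeasurable Measurable.of_discrete.aestronglyMeasurable]
  have hpt : ∀ ω, breg φ φ' (toR (Y ω)) (g (Y ω)) + dotR (φ' (g (Y ω))) (toR (Y ω))
      = breg φ φ' (toR (Yt ω)) (g (Y ω)) + (φ (toR (Y ω)) - φ (toR (Yt ω)))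
        + dotR (φ' (g (Y ω))) (toR (Yt ω)) := by
    intro ω
    simp only [breg, dotR, mul_sub, Finset.sum_sub_distrib]
    ring
  have hd : Integrable (fun ω => φ (toR (Y ω)) - φ (toR (Yt ω))) P := hφY.sub hφYt
  have ha : Integrable (fun ω => breg φ φ' (toR (Yt ω)) (g (Y ω))
      + (φ (toR (Y ω)) - φ (toR (Yt ω)))) P := h4.add hd
  have hs : Integrable (fun ω => breg φ φ' (toR (Yt ω)) (g (Y ω))
      + (φ (toR (Y ω)) - φ (toR (Yt ω))) + dotR (φ' (g (Y ω))) (toR (Yt ω))) P := ha.add h5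
  simp_rw [hpt]
  rw [integral_sub hs h3, integral_add ha h5, integral_add h4 hd,
    integral_sub hφY hφYt, hφ, hinner]
  ring
end
end

section
/- For 0 ≤ p < 1, let Err_p(g) = E[D_φ(Ỹ_p, g(Y_p))] where Y_p, Ỹ_p ~ Pois((1−p)μ) are independent. If for some integer k ≥ 0 one has E[ D_φ(Ỹ, g(Y)) · ⟨Ỹ + Y, 1_n⟩^m ] < ∞ for every m = 0,…,k, where Y, Ỹ ~ Pois(μ) are independent and 1_n is the all-ones vector, then the map p ↦ Err_p(g) has k continuous derivatives on [0,1). In particular, for k = 0, Err_p(g) → Err(g) as p → 0 whenever Err(g) < ∞. -/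
open MeasureTheory ProbabilityTheory Filter Set

noncomputable section

/-- Mean-shrunken test error `Err_p(g) = E[D_φ(Ỹ_p, g(Y_p))]`,
`Y_p, Ỹ_p ~ Pois((1-p)μ)` independent, written as a sum over the discrete sample space. -/
def errFn {n : ℕ} (μ : Fin n → ℝ) (g : (Fin n → ℕ) → Fin n → ℝ)
    (φ : (Fin n → ℝ) → ℝ) (φ' : (Fin n → ℝ) → Fin n → ℝ) (p : ℝ) : ℝ :=
  ∑' yz : (Fin n → ℕ) × (Fin n → ℕ),
    poisPMF (fun i => (1 - p) * μ i) yz.1 * poisPMF (fun i => (1 - p) * μ i) yz.2 *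
      breg φ φ' (toR yz.2) (g yz.1)

/-- `E[D_φ(Ỹ_p, g(Y_p)) ⟨Ỹ_p + Y_p, 1_n⟩]` for `Y_p, Ỹ_p ~ Pois((1-p)μ)` independent. -/
def crossFn {n : ℕ} (μ : Fin n → ℝ) (g : (Fin n → ℕ) → Fin n → ℝ)
    (φ : (Fin n → ℝ) → ℝ) (φ' : (Fin n → ℝ) → Fin n → ℝ) (p : ℝ) : ℝ :=
  ∑' yz : (Fin n → ℕ) × (Fin n → ℕ),
    poisPMF (fun i => (1 - p) * μ i) yz.1 * poisPMF (fun i => (1 - p) * μ i) yz.2 *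
      breg φ φ' (toR yz.2) (g yz.1) * (∑ i, ((yz.1 i : ℝ) + (yz.2 i : ℝ)))

section PowerSeries

variable {ι : Type*} {a : ι → ℝ} {N : ι → ℕ}

lemma continuousOn_tsum_mul_pow (ha : Summable a) :
    ContinuousOn (fun q : ℝ => ∑' i, a i * q ^ N i) (Ioc 0 1) := by
  refine continuousOn_tsum (u := fun i => ‖a i‖) (fun i => by fun_prop) ha.norm
    fun i q hq => ?_
  rw [norm_mul, norm_pow, Real.norm_of_nonneg hq.1.le]
  exact mul_le_of_le_one_right (norm_nonneg _) (pow_le_one₀ hq.1.le hq.2)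

lemma hasDerivAt_tsum_mul_pow (ha : Summable a) (ha' : Summable fun i => a i * N i)
    {q : ℝ} (hq : q ∈ Ioo (0 : ℝ) 1) :
    HasDerivAt (fun q : ℝ => ∑' i, a i * q ^ N i) (∑' i, a i * N i * q ^ (N i - 1)) q := by
  refine hasDerivAt_tsum_of_isPreconnected (g := fun i q => a i * q ^ N i)
    (g' := fun i q => a i * N i * q ^ (N i - 1)) ha'.norm isOpen_Ioo
    isPreconnected_Ioo (fun i x _ => ?_) (fun i x hx => ?_) hq ?_ hq
  · rw [mul_assoc]
    exact (hasDerivAt_pow (N i) x).const_mul (a i)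
  · rw [norm_mul, norm_pow, Real.norm_of_nonneg hx.1.le]
    exact mul_le_of_le_one_right (norm_nonneg _) (pow_le_one₀ hx.1.le hx.2.le)
  · refine ha.norm.of_norm_bounded fun i => ?_
    rw [norm_mul, norm_pow, Real.norm_of_nonneg hq.1.le]
    exact mul_le_of_le_one_right (norm_nonneg _) (pow_le_one₀ hq.1.le hq.2.le)

/-- Abel-type extension of termwise differentiation to the endpoint `1`. -/
lemma hasDerivWithinAt_tsum_mul_pow (ha : Summable a) (ha' : Summable fun i => a i * N i)
    {q : ℝ} (hq : q ∈ Ioc (0 : ℝ) 1) :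
    HasDerivWithinAt (fun q : ℝ => ∑' i, a i * q ^ N i) (∑' i, a i * N i * q ^ (N i - 1))
      (Ioc 0 1) q := by
  rcases hq.2.lt_or_eq with h | rfl
  · exact (hasDerivAt_tsum_mul_pow ha ha' ⟨hq.1, h⟩).hasDerivWithinAt
  have hmem : Ioo (0 : ℝ) 1 ∈ nhdsWithin 1 (Iio 1) := Ioo_mem_nhdsLT one_pos
  have hdiff : DifferentiableOn ℝ (fun q : ℝ => ∑' i, a i * q ^ N i) (Ioo 0 1) := fun x hx =>
    (hasDerivAt_tsum_mul_pow ha ha' hx).differentiableAt.differentiableWithinAt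
  refine (hasDerivWithinAt_Iic_of_tendsto_deriv hdiff
    ((continuousOn_tsum_mul_pow ha 1 hq).mono Ioo_subset_Ioc_self) hmem ?_).mono
    fun x hx => hx.2
  have hcont : ContinuousWithinAt (fun q : ℝ => ∑' i, a i * N i * q ^ (N i - 1)) (Ioc 0 1) 1 :=
    continuousOn_tsum_mul_pow (N := fun i => N i - 1) ha' 1 hq
  refine (hcont.tendsto.mono_left (nhdsWithin_le_of_mem
    (mem_of_superset hmem Ioo_subset_Ioc_self))).congr' ?_
  filter_upwards [hmem] with x hx
  exact (hasDerivAt_tsum_mul_pow ha ha' hx).deriv.symm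

theorem contDiffOn_tsum_mul_pow (k : ℕ) (ha : ∀ m ≤ k, Summable fun i => a i * (N i : ℝ) ^ m) :
    ContDiffOn ℝ k (fun q : ℝ => ∑' i, a i * q ^ N i) (Ioc 0 1) := by
  have huniq : UniqueDiffOn ℝ (Ioc (0 : ℝ) 1) := uniqueDiffOn_Ioc 0 1
  induction k generalizing a N with
  | zero =>
    exact contDiffOn_zero.2 (continuousOn_tsum_mul_pow (by simpa using ha 0 le_rfl))
  | succ k ih =>
    have h0 : Summable a := by simpa using ha 0 (Nat.zero_le _)
    have h1 : Summable fun i => a i * N i := by simpa using ha 1 (by omega)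
    have hderiv := fun q (hq : q ∈ Ioc (0 : ℝ) 1) => hasDerivWithinAt_tsum_mul_pow h0 h1 hq
    rw [Nat.cast_add, Nat.cast_one, contDiffOn_succ_iff_derivWithin huniq]
    refine ⟨fun q hq => (hderiv q hq).differentiableWithinAt, by simp, ?_⟩
    refine (ih (a := fun i => a i * N i) (N := fun i => N i - 1) fun m hm => ?_).congr
      fun q hq => (hderiv q hq).derivWithin (huniq q hq)
    refine (ha (m + 1) (by omega)).norm.of_norm_bounded fun i => ?_
    rw [mul_assoc, norm_mul, norm_mul (a i)]
    gcongr
    rw [pow_succ', norm_mul, norm_mul, norm_pow, norm_pow]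
    gcongr
    simp

end PowerSeries

lemma poisPMF_smul {n : ℕ} (μ : Fin n → ℝ) (p : ℝ) (y : Fin n → ℕ) :
    poisPMF (fun i => (1 - p) * μ i) y =
      Real.exp (p * ∑ i, μ i) * poisPMF μ y * (1 - p) ^ ∑ i, y i := by
  simp only [poisPMF]
  rw [Finset.mul_sum, Real.exp_sum, ← Finset.prod_pow_eq_pow_sum, ← Finset.prod_mul_distrib,
    ← Finset.prod_mul_distrib]
  refine Finset.prod_congr rfl fun i _ => ?_
  rw [show -((1 - p) * μ i) = p * μ i + -μ i by ring, Real.exp_add, mul_pow]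
  ring

lemma errFn_eq_tsum_mul_pow {n : ℕ} (μ : Fin n → ℝ) (g : (Fin n → ℕ) → Fin n → ℝ)
    (φ : (Fin n → ℝ) → ℝ) (φ' : (Fin n → ℝ) → Fin n → ℝ) (p : ℝ) :
    errFn μ g φ φ' p = Real.exp (2 * p * ∑ i, μ i) *
      ∑' yz : (Fin n → ℕ) × (Fin n → ℕ),
        poisPMF μ yz.1 * poisPMF μ yz.2 * breg φ φ' (toR yz.2) (g yz.1) *
          (1 - p) ^ ∑ i, (yz.1 i + yz.2 i) := by
  rw [errFn, ← tsum_mul_left]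
  refine tsum_congr fun yz => ?_
  rw [poisPMF_smul, poisPMF_smul, Finset.sum_add_distrib, pow_add,
    show 2 * p * ∑ i, μ i = p * ∑ i, μ i + p * ∑ i, μ i by ring, Real.exp_add]
  ring

/-- under `k` moments of `D_φ(Ỹ, g(Y)) ⟨Ỹ + Y, 1_n⟩`, the map
`p ↦ Err_p(g)` has `k` continuous derivatives on `[0,1)`; in particular (`k = 0`)
`Err_p(g) → Err(g)` as `p → 0`. -/
theorem stmt11 {n : ℕ} (μ : Fin n → ℝ) (hμ : ∀ i, 0 ≤ μ i)
    (g : (Fin n → ℕ) → Fin n → ℝ)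
    (φ : (Fin n → ℝ) → ℝ) (φ' : (Fin n → ℝ) → Fin n → ℝ)
    (hconv : ConvexOn ℝ Set.univ φ) (hgrad : HasGrad φ φ')
    (k : ℕ)
    (hmom : ∀ m ≤ k, Summable (fun yz : (Fin n → ℕ) × (Fin n → ℕ) =>
      poisPMF μ yz.1 * poisPMF μ yz.2 * breg φ φ' (toR yz.2) (g yz.1) *
        (∑ i, ((yz.1 i : ℝ) + (yz.2 i : ℝ))) ^ m)) :
    ContDiffOn ℝ (k : ℕ∞) (errFn μ g φ φ') (Set.Ico 0 1) ∧
      Tendsto (errFn μ g φ φ') (nhdsWithin 0 (Set.Ico 0 1)) (nhds (errFn μ g φ φ' 0)) := by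
  have hcd : ContDiffOn ℝ (k : ℕ∞) (errFn μ g φ φ') (Set.Ico 0 1) := by
    rw [funext (errFn_eq_tsum_mul_pow μ g φ φ')]
    have hF := contDiffOn_tsum_mul_pow
      (N := fun yz : (Fin n → ℕ) × (Fin n → ℕ) => ∑ i, (yz.1 i + yz.2 i)) k
      fun m hm => by simpa only [Nat.cast_sum, Nat.cast_add] using hmom m hm
    have hsub : ContDiffOn ℝ k (fun p : ℝ => 1 - p) (Set.Ico 0 1) := by fun_prop
    have hexp : ContDiffOn ℝ k (fun p : ℝ => Real.exp (2 * p * ∑ i, μ i)) (Set.Ico 0 1) := by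
      fun_prop
    exact hexp.mul (hF.comp hsub fun p hp => ⟨by linarith [hp.2], by linarith [hp.1]⟩)
  exact ⟨hcd, hcd.continuousOn 0 ⟨le_rfl, one_pos⟩⟩
end
end

section
/- For 0 ≤ p < 1, let Y_p, Ỹ_p ~ Pois((1−p)μ) be independent and let f(Y_p, Ỹ_p) = D_φ(Ỹ_p, g(Y_p)). If E[ f(Y_p, Ỹ_p) ] < ∞ and E[ f(Y_p, Ỹ_p)·⟨Ỹ_p + Y_p, 1_n⟩ ] < ∞ for all p in an interval, then on that interval ∂/∂p E[f(Y_p, Ỹ_p)] = 2(Σ_{i=1}^n μ_i)·E[f(Y_p, Ỹ_p)] − (1/(1−p))·E[ f(Y_p, Ỹ_p)·⟨Ỹ_p + Y_p, 1_n⟩ ]. -/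
open MeasureTheory ProbabilityTheory Filter Set

noncomputable section

/-- Termwise differentiation, within a convex set, of a series whose derivatives are dominated by
a summable sequence. -/
theorem hasDerivWithinAt_tsum_of_convex {ι : Type*} {f f' : ι → ℝ → ℝ} {u : ι → ℝ} {s : Set ℝ}
    (hs : Convex ℝ s) (hu : Summable u) (hf : ∀ x ∈ s, Summable fun i => f i x)
    (hd : ∀ i, ∀ x ∈ s, HasDerivWithinAt (f i) (f' i x) s x)
    (hbound : ∀ i, ∀ x ∈ s, ‖f' i x‖ ≤ u i) {x : ℝ} (hx : x ∈ s) :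
    HasDerivWithinAt (fun t => ∑' i, f i t) (∑' i, f' i x) s x := by
  rw [hasDerivWithinAt_iff_tendsto_slope]
  have key : Tendsto (fun t => ∑' i, slope (f i) x t) (nhdsWithin x (s \ {x}))
      (nhds (∑' i, f' i x)) := by
    refine tendsto_tsum_of_dominated_convergence hu
      (fun i => hasDerivWithinAt_iff_tendsto_slope.1 (hd i x hx)) ?_
    filter_upwards [self_mem_nhdsWithin] with t ht i
    have hpos : 0 < ‖t - x‖ := norm_pos_iff.2 (sub_ne_zero.2 ht.2)
    rw [slope_def_field, norm_div, div_le_iff₀ hpos]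
    exact hs.norm_image_sub_le_of_norm_hasDerivWithin_le (hd i) (hbound i) hx ht.1
  refine key.congr' ?_
  filter_upwards [self_mem_nhdsWithin] with t ht
  simp only [slope_def_field]
  rw [tsum_div_const, (hf t ht.1).tsum_sub (hf x hx)]

theorem poisPMF_const_mul {n : ℕ} (s : ℝ) (μ : Fin n → ℝ) (y : Fin n → ℕ) :
    poisPMF (fun i => s * μ i) y =
      Real.exp (-(s * ∑ i, μ i)) * s ^ (∑ i, y i) * ∏ i, μ i ^ y i / (y i).factorial := by
  rw [poisPMF, Finset.mul_sum, ← Finset.sum_neg_distrib, Real.exp_sum, ← Finset.prod_pow_eq_pow_sum,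
    ← Finset.prod_mul_distrib, ← Finset.prod_mul_distrib]
  exact Finset.prod_congr rfl fun i _ => by rw [mul_pow]; ring

theorem hasDerivAt_exp_mul_one_sub_pow (M c : ℝ) (N : ℕ) (p : ℝ) :
    HasDerivAt (fun p => Real.exp (-(2 * M * (1 - p))) * (1 - p) ^ N * c)
      (Real.exp (-(2 * M * (1 - p))) * (2 * M * (1 - p) ^ N - N * (1 - p) ^ (N - 1)) * c) p := by
  have h1 : HasDerivAt (fun p : ℝ => 1 - p) (-1) p := by
    simpa using (hasDerivAt_id p).const_sub 1
  have h2 := (((h1.const_mul (2 * M)).neg.exp).mul (h1.pow N)).mul_const c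
  refine HasDerivAt.congr_deriv (f := fun p => Real.exp (-(2 * M * (1 - p))) * (1 - p) ^ N * c)
    h2 ?_
  simp only [Pi.pow_apply, Pi.neg_apply]
  ring

/-- Termwise differentiation of `∑ exp (-2M(1-p)) (1-p)^Nᵢ cᵢ`. -/
theorem hasDerivWithinAt_tsum_exp_mul_one_sub_pow {ι : Type*} {M : ℝ} (hM : 0 ≤ M) (N : ι → ℕ)
    (c : ι → ℝ) {a b : ℝ} (hb : b ≤ 1)
    (h1 : ∀ p ∈ Set.Ico a b, Summable fun i =>
      Real.exp (-(2 * M * (1 - p))) * (1 - p) ^ N i * c i)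
    (h2 : ∀ p ∈ Set.Ico a b, Summable fun i =>
      Real.exp (-(2 * M * (1 - p))) * (1 - p) ^ N i * c i * N i)
    {p : ℝ} (hp : p ∈ Set.Ico a b) :
    HasDerivWithinAt (fun p => ∑' i, Real.exp (-(2 * M * (1 - p))) * (1 - p) ^ N i * c i)
      (2 * M * (∑' i, Real.exp (-(2 * M * (1 - p))) * (1 - p) ^ N i * c i) -
        (1 - p)⁻¹ * ∑' i, Real.exp (-(2 * M * (1 - p))) * (1 - p) ^ N i * c i * N i)
      (Set.Ico a b) p := by
  have hab : a < b := hp.1.trans_lt hp.2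
  have haI : a ∈ Set.Ico a b := ⟨le_rfl, hab⟩
  have hpow : ∀ (q : ℝ) (k : ℕ), q < 1 → (k : ℝ) * (1 - q) ^ (k - 1) =
      (1 - q)⁻¹ * ((1 - q) ^ k * k) := by
    intro q k hq
    have hq0 : (1 - q) ≠ 0 := by linarith
    cases k with
    | zero => simp
    | succ k => rw [Nat.add_sub_cancel, pow_succ]; field_simp
  have hu : Summable fun i => Real.exp (2 * M * (1 - a)) *
      (2 * M * |Real.exp (-(2 * M * (1 - a))) * (1 - a) ^ N i * c i| +
        (1 - a)⁻¹ * |Real.exp (-(2 * M * (1 - a))) * (1 - a) ^ N i * c i * N i|) :=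
    (((h1 a haI).abs.mul_left _).add ((h2 a haI).abs.mul_left _)).mul_left _
  have key := hasDerivWithinAt_tsum_of_convex (convex_Ico a b) hu h1
    (fun i q _ => (hasDerivAt_exp_mul_one_sub_pow M (c i) (N i) q).hasDerivWithinAt) ?_ hp
  · convert key using 1
    rw [← tsum_mul_left, ← tsum_mul_left,
      ← ((h1 p hp).mul_left _).tsum_sub ((h2 p hp).mul_left _)]
    refine tsum_congr fun i => ?_
    rw [hpow p (N i) (hp.2.trans_le hb)]
    ring
  · intro i q hq
    have hq0 : 0 ≤ 1 - q := by linarith [hq.2]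
    have hqa : 1 - q ≤ 1 - a := by linarith [hq.1]
    have ha0 : 0 ≤ 1 - a := hq0.trans hqa
    have hE : Real.exp (-(2 * M * (1 - q))) ≤ 1 := Real.exp_le_one_iff.2 (by
      have := mul_nonneg hM hq0
      linarith)
    have hR : Real.exp (2 * M * (1 - a)) *
        (2 * M * |Real.exp (-(2 * M * (1 - a))) * (1 - a) ^ N i * c i| +
        (1 - a)⁻¹ * |Real.exp (-(2 * M * (1 - a))) * (1 - a) ^ N i * c i * N i|) =
        (2 * M * (1 - a) ^ N i + N i * (1 - a) ^ (N i - 1)) * |c i| := by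
      rw [hpow a (N i) (hab.trans_le hb), Real.exp_neg]
      simp only [abs_mul, abs_inv, Real.abs_exp, abs_pow, abs_of_nonneg ha0, Nat.abs_cast]
      field_simp
    rw [hR, norm_mul, norm_mul, Real.norm_eq_abs (c i), Real.norm_eq_abs, Real.abs_exp]
    refine mul_le_mul_of_nonneg_right ?_ (abs_nonneg _)
    refine (mul_le_of_le_one_left (norm_nonneg _) hE).trans ((norm_sub_le _ _).trans ?_)
    rw [Real.norm_of_nonneg (by positivity), Real.norm_of_nonneg (by positivity)]
    gcongr

/-- derivative formula for the mean-shrunken test error: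
`∂/∂p E[f(Y_p, Ỹ_p)] = 2(Σ_i μ_i) E[f] - (1/(1-p)) E[f ⟨Ỹ_p + Y_p, 1_n⟩]` on an interval. -/
theorem stmt12 {n : ℕ} (μ : Fin n → ℝ) (hμ : ∀ i, 0 ≤ μ i)
    (g : (Fin n → ℕ) → Fin n → ℝ)
    (φ : (Fin n → ℝ) → ℝ) (φ' : (Fin n → ℝ) → Fin n → ℝ)
    (hconv : ConvexOn ℝ Set.univ φ) (hgrad : HasGrad φ φ')
    (a b : ℝ) (ha : 0 ≤ a) (hb : b ≤ 1)
    (hsum1 : ∀ p ∈ Set.Ico a b, Summable (fun yz : (Fin n → ℕ) × (Fin n → ℕ) =>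
      poisPMF (fun i => (1 - p) * μ i) yz.1 * poisPMF (fun i => (1 - p) * μ i) yz.2 *
        breg φ φ' (toR yz.2) (g yz.1)))
    (hsum2 : ∀ p ∈ Set.Ico a b, Summable (fun yz : (Fin n → ℕ) × (Fin n → ℕ) =>
      poisPMF (fun i => (1 - p) * μ i) yz.1 * poisPMF (fun i => (1 - p) * μ i) yz.2 *
        breg φ φ' (toR yz.2) (g yz.1) * (∑ i, ((yz.1 i : ℝ) + (yz.2 i : ℝ))))) :
    ∀ p ∈ Set.Ico a b,
      HasDerivWithinAt (errFn μ g φ φ')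
        (2 * (∑ i, μ i) * errFn μ g φ φ' p - (1 - p)⁻¹ * crossFn μ g φ φ' p)
        (Set.Ico a b) p := by
  have hterm : ∀ (p : ℝ) (yz : (Fin n → ℕ) × (Fin n → ℕ)),
      poisPMF (fun i => (1 - p) * μ i) yz.1 * poisPMF (fun i => (1 - p) * μ i) yz.2 *
        breg φ φ' (toR yz.2) (g yz.1) =
      Real.exp (-(2 * (∑ i, μ i) * (1 - p))) * (1 - p) ^ (∑ i, (yz.1 i + yz.2 i)) *
        ((∏ i, μ i ^ yz.1 i / (yz.1 i).factorial) * (∏ i, μ i ^ yz.2 i / (yz.2 i).factorial) *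
          breg φ φ' (toR yz.2) (g yz.1)) := by
    intro p yz
    have hexp : Real.exp (-(2 * (∑ i, μ i) * (1 - p))) =
        Real.exp (-((1 - p) * ∑ i, μ i)) * Real.exp (-((1 - p) * ∑ i, μ i)) := by
      rw [← Real.exp_add]
      ring_nf
    rw [poisPMF_const_mul, poisPMF_const_mul, hexp, Finset.sum_add_distrib, pow_add]
    ring
  have hcast : ∀ yz : (Fin n → ℕ) × (Fin n → ℕ),
      ∑ i, ((yz.1 i : ℝ) + (yz.2 i : ℝ)) = ((∑ i, (yz.1 i + yz.2 i) : ℕ) : ℝ) := by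
    intro yz
    push_cast
    rfl
  intro p hp
  simp only [hterm, hcast] at hsum1 hsum2
  unfold errFn crossFn
  simp only [hterm, hcast]
  exact hasDerivWithinAt_tsum_exp_mul_one_sub_pow (Finset.sum_nonneg fun i _ => hμ i) _ _ hb
    hsum1 hsum2 hp
end
end

section
/- Fix y ∈ ℤ_+^n and let h : ℤ_+^n → ℝ_+^n (extended by h(z) = 0 for z with a negative entry). For p ∈ (0,1), draw ω_i ~ Binomial(y_i, p) independently across i = 1,…,n. Then for each i, lim_{p → 0} ((1−p)/p) · E[ ω_i · h_i(y − ω) ] = y_i · h_i(y − e_i), where the right-hand side is interpreted as 0 when y_i = 0. -/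
open MeasureTheory ProbabilityTheory Filter Set

noncomputable section

lemma binomPMF_zero_right (m k : ℕ) : binomPMF m k 0 = if k = 0 then 1 else 0 := by
  rcases eq_or_ne k 0 with rfl | hk <;> simp [binomPMF, *]

lemma continuous_binomPMF (m k : ℕ) : Continuous (binomPMF m k) := by
  unfold binomPMF
  fun_prop

lemma binomJointPMF_eq_zero {n : ℕ} {y w : Fin n → ℕ} (hw : ¬ w ≤ y) (p : ℝ) :
    binomJointPMF y p w = 0 := by
  obtain ⟨j, hj⟩ := not_forall.mp hw
  refine Finset.prod_eq_zero (Finset.mem_univ j) ?_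
  simp [binomPMF, Nat.choose_eq_zero_of_lt (not_le.mp hj)]

/-- After division by `p`, only the unit vector `e_i` keeps a nonzero weight as `p → 0`. -/
lemma tendsto_div_mul_binomJointPMF {n : ℕ} (y w : Fin n → ℕ) (i : Fin n) :
    Tendsto (fun p : ℝ => (1 - p) / p * (binomJointPMF y p w * (w i : ℝ)))
      (nhdsWithin 0 (Set.Ioo 0 1)) (nhds (if w = Pi.single i 1 then (y i : ℝ) else 0)) := by
  rcases hwi : w i with _ | k
  · have hne : w ≠ Pi.single i 1 := by
      rintro rfl
      simp at hwi
    simp [hne]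
  · set g : ℝ → ℝ := fun p => (1 - p) * (((y i).choose (k + 1) : ℝ) * p ^ k *
      (1 - p) ^ (y i - (k + 1)) * ∏ j ∈ Finset.univ.erase i, binomPMF (y j) (w j) p) *
      ((k + 1 : ℕ) : ℝ) with hg
    have hcont : Continuous g := by
      have := fun j => continuous_binomPMF (y j) (w j)
      fun_prop
    have hg0 : g 0 = if w = Pi.single i 1 then (y i : ℝ) else 0 := by
      simp only [hg, binomPMF_zero_right]
      split_ifs with hw
      · subst hw
        obtain rfl : k = 0 := by simpa using hwi.symm
        rw [Finset.prod_eq_one]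
        · simp
        · intro j hj
          simp [Finset.ne_of_mem_erase hj]
      · rcases eq_or_ne k 0 with rfl | hk
        · obtain ⟨j, hj⟩ := Function.ne_iff.mp hw
          have hji : j ≠ i := by
            rintro rfl
            simp [hwi] at hj
          rw [Finset.prod_eq_zero (i := j) (by simp [hji]) (by simpa [hji] using hj)]
          simp
        · simp [hk]
    rw [← hg0]
    refine (hcont.continuousAt.tendsto.mono_left nhdsWithin_le_nhds).congr' ?_
    filter_upwards [self_mem_nhdsWithin] with p hp
    have hp0 : p ≠ 0 := hp.1.ne'
    rw [binomJointPMF, ← Finset.mul_prod_erase _ _ (Finset.mem_univ i), hwi]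
    simp only [hg, binomPMF]
    field_simp
    ring

/-- for fixed `y` and `ω_i ~ Binom(y_i, p)` independent,
`((1-p)/p) E[ω_i h_i(y - ω)] → y_i h_i(y - e_i)` as `p → 0`. -/
theorem stmt14 {n : ℕ} (y : Fin n → ℕ) (h : (Fin n → ℕ) → Fin n → ℝ)
    (hpos : ∀ z i, 0 ≤ h z i) (i : Fin n) :
    Tendsto (fun p : ℝ =>
        (1 - p) / p * ∑' w : Fin n → ℕ, binomJointPMF y p w * (w i : ℝ) * h (y - w) i)
      (nhdsWithin 0 (Set.Ioo 0 1)) (nhds ((y i : ℝ) * h (y - Pi.single i 1) i)) := by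
  have hsum : ∀ p : ℝ,
      (1 - p) / p * ∑' w : Fin n → ℕ, binomJointPMF y p w * (w i : ℝ) * h (y - w) i =
        ∑ w ∈ Finset.Icc 0 y, (1 - p) / p * (binomJointPMF y p w * (w i : ℝ)) * h (y - w) i := by
    intro p
    rw [tsum_eq_sum (s := Finset.Icc 0 y), Finset.mul_sum]
    · simp only [mul_assoc]
    · intro w hw
      have hwy : ¬ w ≤ y := fun hle => hw (Finset.mem_Icc.mpr ⟨zero_le, hle⟩)
      simp [binomJointPMF_eq_zero hwy]
  simp only [hsum]
  convert tendsto_finsetSum (Finset.Icc 0 y) fun w _ =>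
    (tendsto_div_mul_binomJointPMF y w i).mul_const (h (y - w) i) using 2
  simp only [ite_mul, zero_mul, Finset.sum_ite_eq']
  split_ifs with hmem
  · rfl
  · have hyi : y i = 0 := by
      by_contra hne
      refine hmem (Finset.mem_Icc.mpr ⟨zero_le, fun j => ?_⟩)
      rcases eq_or_ne j i with rfl | hji
      · simpa [Nat.one_le_iff_ne_zero] using hne
      · simp [hji]
    simp [hyi]
end
end

section
/- (Bias bound.) For 0 ≤ t < 1 let Y_t, Ỹ_t ~ Pois((1−t)μ) be independent and Err_t(g) = E[D_φ(Ỹ_t, g(Y_t))]. Assume E[ D_φ(Ỹ_t, g(Y_t)) · ⟨Y_t + Ỹ_t, 1_n⟩ ] < ∞ for all t in the relevant range, and that t ↦ Var[ D_φ(Ỹ_t, g(Y_t)) ] is decreasing on [0, 1/2]. Then for every p ∈ [0, 1/2], |Err_p(g) − Err(g)| ≤ (5p/3) · √( Var[ D_φ(Ỹ, g(Y)) ] · Σ_{i=1}^n μ_i ), where Y, Ỹ ~ Pois(μ) are independent. -/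
open MeasureTheory ProbabilityTheory Filter Set

noncomputable section

/-- `E[D_φ(Ỹ_p, g(Y_p))²]` for `Y_p, Ỹ_p ~ Pois((1-p)μ)` independent. -/
def sqFn {n : ℕ} (μ : Fin n → ℝ) (g : (Fin n → ℕ) → Fin n → ℝ)
    (φ : (Fin n → ℝ) → ℝ) (φ' : (Fin n → ℝ) → Fin n → ℝ) (p : ℝ) : ℝ :=
  ∑' yz : (Fin n → ℕ) × (Fin n → ℕ),
    poisPMF (fun i => (1 - p) * μ i) yz.1 * poisPMF (fun i => (1 - p) * μ i) yz.2 *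
      (breg φ φ' (toR yz.2) (g yz.1)) ^ 2

/-! ### Power series indexed by an arbitrary type -/

/-- Termwise differentiation of `∑ aᵢ s ^ kᵢ` strictly inside an interval `[0, S]`. -/
lemma hasDerivAt_tsum_mul_pow_s17 {ι : Type*} {a : ι → ℝ} {k : ι → ℕ} {s S : ℝ} (hs : 0 < s)
    (hsS : s < S) (ha : Summable fun i => a i * S ^ k i)
    (hak : Summable fun i => a i * k i * S ^ k i) :
    HasDerivAt (fun x => ∑' i, a i * x ^ k i) ((∑' i, a i * k i * s ^ k i) / s) s := by
  have hS : 0 < S := hs.trans hsS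
  have hshift : ∀ x : ℝ, 0 < x → ∀ i, a i * (k i * x ^ (k i - 1)) = a i * k i * x ^ k i / x := by
    intro x hx i
    rcases Nat.eq_zero_or_pos (k i) with h | h
    · simp [h]
    · rw [eq_div_iff hx.ne']
      rw [← pow_sub_one_mul h.ne' x]
      ring
  have hbound : Summable fun i => ‖a i * k i * S ^ k i / S‖ := (hak.div_const S).norm
  rw [← tsum_div_const]
  simp_rw [← hshift s hs]
  refine hasDerivAt_tsum_of_isPreconnected hbound isOpen_Ioo isPreconnected_Ioo
    (t := Ioo 0 S) (g' := fun i x => a i * (k i * x ^ (k i - 1)))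
    (fun i x _ => (hasDerivAt_pow (k i) x).const_mul (a i)) ?_ ⟨hs, hsS⟩ ?_ ⟨hs, hsS⟩
  · intro i x hx
    rw [← hshift S hS i, norm_mul, norm_mul, norm_mul, norm_mul, norm_pow, norm_pow,
      Real.norm_of_nonneg hx.1.le, Real.norm_of_nonneg hS.le]
    have := hx.1.le
    gcongr
    exact hx.2.le
  · refine Summable.of_norm_bounded ha.norm fun i => ?_
    rw [norm_mul, norm_mul, norm_pow, norm_pow, Real.norm_of_nonneg hs.le,
      Real.norm_of_nonneg hS.le]
    gcongr

/-- A series `∑ aᵢ s ^ kᵢ` summable at every `s ≥ 0` stays so after multiplying by `kᵢ`. -/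
lemma summable_mul_natCast_mul_pow {ι : Type*} {a : ι → ℝ} {k : ι → ℕ}
    (ha : ∀ s : ℝ, 0 ≤ s → Summable fun i => a i * s ^ k i) {s : ℝ} (hs : 0 ≤ s) :
    Summable fun i => a i * k i * s ^ k i := by
  refine Summable.of_norm_bounded (ha (2 * s) (by positivity)).norm fun i => ?_
  rw [norm_mul, norm_mul, norm_mul, mul_assoc, mul_pow, norm_mul]
  gcongr
  rw [Real.norm_natCast, Real.norm_of_nonneg (by positivity)]
  exact_mod_cast (Nat.lt_two_pow_self (n := k i)).le

/-- `∑ aᵢ kᵢ s ^ kᵢ = s F'(s)` when `F(s) = ∑ aᵢ s ^ kᵢ`. -/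
lemma hasSum_mul_natCast_mul_pow {ι : Type*} {a : ι → ℝ} {k : ι → ℕ} {F : ℝ → ℝ}
    (ha : ∀ s : ℝ, 0 ≤ s → Summable fun i => a i * s ^ k i)
    (hF : ∀ s : ℝ, 0 < s → ∑' i, a i * s ^ k i = F s) {s F' : ℝ} (hs : 0 < s)
    (hF' : HasDerivAt F F' s) : HasSum (fun i => a i * k i * s ^ k i) (s * F') := by
  have hd := hasDerivAt_tsum_mul_pow_s17 hs (lt_add_one s) (ha (s + 1) (by positivity))
    (summable_mul_natCast_mul_pow ha (by positivity))
  have hd' : HasDerivAt F ((∑' i, a i * k i * s ^ k i) / s) s :=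
    hd.congr_of_eventuallyEq <| by
      filter_upwards [lt_mem_nhds hs] with x hx using (hF x hx).symm
  have hsum : ∑' i, a i * k i * s ^ k i = s * F' := by
    rw [hF'.unique hd', mul_div_cancel₀ _ hs.ne']
  exact hsum ▸ (summable_mul_natCast_mul_pow ha hs.le).hasSum

/-! ### Covariance inequality for discrete weights -/

/-- Cauchy–Schwarz for the covariance of `f` and `k` under a discrete probability weight. -/
lemma sq_covariance_le_of_hasSum {ι : Type*} {w f k : ι → ℝ} {e q m v x : ℝ}
    (hw : ∀ i, 0 ≤ w i) (h1 : HasSum w 1) (hk : HasSum (fun i => w i * k i) m)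
    (hkk : HasSum (fun i => w i * k i ^ 2) (v + m ^ 2)) (hf : HasSum (fun i => w i * f i) e)
    (hff : HasSum (fun i => w i * f i ^ 2) q) (hfk : HasSum (fun i => w i * f i * k i) x) :
    (x - e * m) ^ 2 ≤ (q - e ^ 2) * v := by
  have hquad : ∀ r : ℝ, 0 ≤ v * (r * r) + (-2 * (x - e * m)) * r + (q - e ^ 2) := by
    intro r
    have hsum := ((((hff.add (hfk.mul_left (-2 * r))).add (hkk.mul_left (r ^ 2))).add
      (hf.mul_left (-2 * (e - r * m)))).add (hk.mul_left (2 * r * (e - r * m)))).add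
      (h1.mul_left ((e - r * m) ^ 2))
    have hnn := hsum.nonneg fun i => by
      have h : 0 ≤ w i * (f i - e - r * (k i - m)) ^ 2 := mul_nonneg (hw i) (sq_nonneg _)
      nlinarith [h]
    nlinarith [hnn]
  have := discrim_le_zero hquad
  rw [discrim] at this
  nlinarith

/-! ### Exponential families with a Poisson total count -/

/-- The weight `exp(-sL) cᵢ s ^ kᵢ`; it has total mass one when `∑ cᵢ s ^ kᵢ = exp(sL)`. -/
def tiltedWeight {ι : Type*} (c : ι → ℝ) (k : ι → ℕ) (L s : ℝ) (i : ι) : ℝ :=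
  Real.exp (-(s * L)) * (c i * s ^ k i)

section Tilted

variable {ι : Type*} {c f : ι → ℝ} {k : ι → ℕ} {L : ℝ}

lemma tiltedWeight_mul (s x : ℝ) (i : ι) :
    tiltedWeight c k L s i * x = Real.exp (-(s * L)) * (c i * x * s ^ k i) := by
  rw [tiltedWeight]
  ring

lemma summable_tiltedWeight_mul_iff {s : ℝ} {h : ι → ℝ} :
    (Summable fun i => tiltedWeight c k L s i * h i) ↔
      Summable fun i => c i * h i * s ^ k i := by
  simp_rw [tiltedWeight_mul]
  exact summable_mul_left_iff (Real.exp_pos _).ne'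

lemma hasSum_tiltedWeight {s : ℝ} (hs : 0 ≤ s)
    (hZ : ∀ s : ℝ, 0 ≤ s → HasSum (fun i => c i * s ^ k i) (Real.exp (s * L))) :
    HasSum (tiltedWeight c k L s) 1 := by
  have := (hZ s hs).mul_left (Real.exp (-(s * L)))
  rwa [← Real.exp_add, neg_add_cancel, Real.exp_zero] at this

lemma hasSum_mul_natCast_mul_pow_exp
    (hZ : ∀ s : ℝ, 0 ≤ s → HasSum (fun i => c i * s ^ k i) (Real.exp (s * L))) {s : ℝ}
    (hs : 0 < s) :
    HasSum (fun i => c i * k i * s ^ k i) (s * (Real.exp (s * L) * L)) :=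
  hasSum_mul_natCast_mul_pow (fun s hs => (hZ s hs).summable) (fun s hs => (hZ s hs.le).tsum_eq)
    hs (hasDerivAt_mul_const L).exp

lemma hasSum_tiltedWeight_mul_natCast {s : ℝ} (hs : 0 < s)
    (hZ : ∀ s : ℝ, 0 ≤ s → HasSum (fun i => c i * s ^ k i) (Real.exp (s * L))) :
    HasSum (fun i => tiltedWeight c k L s i * k i) (s * L) := by
  simp_rw [tiltedWeight_mul]
  convert! (hasSum_mul_natCast_mul_pow_exp hZ hs).mul_left (Real.exp (-(s * L))) using 1
  rw [Real.exp_neg]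
  field_simp

lemma hasSum_tiltedWeight_mul_natCast_sq {s : ℝ} (hs : 0 < s)
    (hZ : ∀ s : ℝ, 0 ≤ s → HasSum (fun i => c i * s ^ k i) (Real.exp (s * L))) :
    HasSum (fun i => tiltedWeight c k L s i * (k i : ℝ) ^ 2) (s * L + (s * L) ^ 2) := by
  have hd : HasDerivAt (fun s => s * (Real.exp (s * L) * L))
      (1 * (Real.exp (s * L) * L) + s * (Real.exp (s * L) * L * L)) s :=
    (hasDerivAt_id s).mul ((hasDerivAt_mul_const L).exp.mul_const L)
  have := hasSum_mul_natCast_mul_pow (a := fun i => c i * k i) (k := k)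
    (fun s hs => summable_mul_natCast_mul_pow (fun s hs => (hZ s hs).summable) hs)
    (fun s hs => (hasSum_mul_natCast_mul_pow_exp hZ hs).tsum_eq) hs hd
  convert! this.mul_left (Real.exp (-(s * L))) using 1
  · ext i
    rw [tiltedWeight]
    ring
  · rw [Real.exp_neg]
    field_simp

/-- The derivative in `s` of a mean under `tiltedWeight` is `Cov(f, k) / s`. -/
lemma hasDerivAt_tsum_tiltedWeight_mul (h1 : Summable fun i => tiltedWeight c k L 1 i * f i)
    (h1k : Summable fun i => tiltedWeight c k L 1 i * f i * k i) {s : ℝ} (hs : 0 < s)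
    (hs1 : s < 1) :
    HasDerivAt (fun s => ∑' i, tiltedWeight c k L s i * f i)
      (((∑' i, tiltedWeight c k L s i * f i * k i) -
        (∑' i, tiltedWeight c k L s i * f i) * (s * L)) / s) s := by
  simp_rw [mul_assoc _ (f _)] at h1k ⊢
  rw [summable_tiltedWeight_mul_iff] at h1 h1k
  simp_rw [← mul_assoc] at h1k
  simp_rw [tiltedWeight_mul, tsum_mul_left, ← mul_assoc]
  convert! (hasDerivAt_mul_const L).neg.exp.mul (hasDerivAt_tsum_mul_pow_s17 hs hs1 h1 h1k) using 1
  simp only [Pi.neg_apply]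
  field_simp
  ring

lemma continuousOn_tsum_tiltedWeight_mul (h1 : Summable fun i => tiltedWeight c k L 1 i * f i) :
    ContinuousOn (fun s => ∑' i, tiltedWeight c k L s i * f i) (Icc 0 1) := by
  rw [summable_tiltedWeight_mul_iff] at h1
  simp_rw [tiltedWeight_mul, tsum_mul_left]
  refine ContinuousOn.mul (by fun_prop) (continuousOn_tsum (fun i => by fun_prop) h1.norm ?_)
  intro i s hs
  rw [one_pow, mul_one, norm_mul, norm_pow, Real.norm_of_nonneg hs.1]
  exact mul_le_of_le_one_right (norm_nonneg _) (pow_le_one₀ hs.1 hs.2)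

/-- If the variance of `f` is at most `V` along the family with parameters in `[a, 1]`, then the
mean of `f` moves by at most `2 √(V L) (1 - √a)`. -/
theorem abs_tsum_tiltedWeight_sub_le (hc : ∀ i, 0 ≤ c i) (hL : 0 ≤ L)
    (hZ : ∀ s : ℝ, 0 ≤ s → HasSum (fun i => c i * s ^ k i) (Real.exp (s * L))) {a V : ℝ}
    (ha : 0 < a) (ha1 : a ≤ 1)
    (hf : ∀ s ∈ Icc a 1, Summable fun i => tiltedWeight c k L s i * f i)
    (hfk : ∀ s ∈ Icc a 1, Summable fun i => tiltedWeight c k L s i * f i * k i)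
    (hff : ∀ s ∈ Icc a 1, Summable fun i => tiltedWeight c k L s i * f i ^ 2)
    (hV : ∀ s ∈ Icc a 1, (∑' i, tiltedWeight c k L s i * f i ^ 2) -
      (∑' i, tiltedWeight c k L s i * f i) ^ 2 ≤ V) :
    |(∑' i, tiltedWeight c k L a i * f i) - ∑' i, tiltedWeight c k L 1 i * f i| ≤
      2 * √(V * L) * (1 - √a) := by
  set E : ℝ → ℝ := fun s => ∑' i, tiltedWeight c k L s i * f i
  set E' : ℝ → ℝ := fun s => ((∑' i, tiltedWeight c k L s i * f i * k i) - E s * (s * L)) / s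
    with hE'
  have h1 : (1 : ℝ) ∈ Icc a 1 := ⟨ha1, le_rfl⟩
  have hderiv : ∀ s ∈ Ioo a 1, HasDerivAt E (E' s) s := fun s hs =>
    hasDerivAt_tsum_tiltedWeight_mul (hf 1 h1) (hfk 1 h1) (ha.trans hs.1) hs.2
  have hbound : ∀ s ∈ Ioo a 1, |E' s| ≤ √(V * L) / √s := by
    intro s hs
    have hs0 : 0 < s := ha.trans hs.1
    have hsI := Ioo_subset_Icc_self hs
    have hcov := sq_covariance_le_of_hasSum
      (fun i => mul_nonneg (Real.exp_pos _).le (mul_nonneg (hc i) (pow_nonneg hs0.le _)))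
      (hasSum_tiltedWeight hs0.le hZ) (hasSum_tiltedWeight_mul_natCast hs0 hZ)
      (hasSum_tiltedWeight_mul_natCast_sq hs0 hZ) (hf s hsI).hasSum (hff s hsI).hasSum
      (hfk s hsI).hasSum
    have hVL := mul_le_mul_of_nonneg_right (hV s hsI) (mul_nonneg hs0.le hL)
    rw [← Real.sqrt_div' _ hs0.le]
    refine Real.abs_le_sqrt ?_
    rw [hE', div_pow, div_le_div_iff₀ (by positivity) hs0]
    nlinarith [mul_le_mul_of_nonneg_right (hcov.trans hVL) hs0.le]
  have hcont : ContinuousOn E (Icc a 1) :=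
    (continuousOn_tsum_tiltedWeight_mul (hf 1 h1)).mono (Icc_subset_Icc_left ha.le)
  have hmono : ∀ σ : ℝ, |σ| = 1 → 0 ≤ 2 * √(V * L) * (1 - √a) + σ * (E 1 - E a) := by
    intro σ hσ
    have hG : ∀ s ∈ Ioo a 1, HasDerivAt (fun s => 2 * √(V * L) * √s + σ * E s)
        (2 * √(V * L) * (1 / (2 * √s)) + σ * E' s) s := fun s hs =>
      ((Real.hasDerivAt_sqrt (ha.trans hs.1).ne').const_mul _).add ((hderiv s hs).const_mul σ)
    have := monotoneOn_of_deriv_nonneg (convex_Icc a 1)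
      (f := fun s => 2 * √(V * L) * √s + σ * E s)
      ((by fun_prop : ContinuousOn (fun s => 2 * √(V * L) * √s) _).add
        (hcont.const_smul σ))
      (fun s hs => by
        rw [interior_Icc] at hs
        exact (hG s hs).differentiableAt.differentiableWithinAt)
      (fun s hs => by
        rw [interior_Icc] at hs
        rw [(hG s hs).deriv]
        have hb := hbound s hs
        have hσE : -|E' s| ≤ σ * E' s := by
          simpa [abs_mul, hσ] using neg_abs_le (σ * E' s)
        have heq : 2 * √(V * L) * (1 / (2 * √s)) = √(V * L) / √s := by
          field_simp
        linarith)
      (left_mem_Icc.2 ha1) (right_mem_Icc.2 ha1) ha1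
    simp only [Real.sqrt_one] at this
    linarith
  have hp := hmono 1 (by simp)
  have hm := hmono (-1) (by simp)
  exact abs_le.2 ⟨by linarith, by linarith⟩

end Tilted

/-! ### The product Poisson law -/

lemma poisPMF_nonneg {n : ℕ} {ν : Fin n → ℝ} (hν : ∀ i, 0 ≤ ν i) (y : Fin n → ℕ) :
    0 ≤ poisPMF ν y :=
  Finset.prod_nonneg fun i _ => by
    have := hν i
    positivity

lemma hasSum_poisPMF {n : ℕ} {ν : Fin n → ℝ} (hν : ∀ i, 0 ≤ ν i) : HasSum (poisPMF ν) 1 := by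
  let P : Measure (Fin n → ℕ) := Measure.pi fun i => poissonMeasure (ν i).toNNReal
  have hP : ∀ y, P {y} = ENNReal.ofReal (poisPMF ν y) := by
    intro y
    rw [Measure.pi_singleton, poisPMF, ENNReal.ofReal_prod_of_nonneg fun i _ => by
      have := hν i
      positivity]
    exact Finset.prod_congr rfl fun i _ => by
      rw [poissonMeasure_singleton, Real.coe_toNNReal _ (hν i)]
  have htsum : ∑' y, P {y} = 1 := by
    simpa [P] using P.tsum_indicator_apply_singleton univ MeasurableSet.univ
  simp_rw [hP] at htsum
  have hsum := ENNReal.hasSum_toReal (f := fun y => ENNReal.ofReal (poisPMF ν y))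
    (by simp [htsum])
  rw [← ENNReal.tsum_toReal_eq (by simp), htsum] at hsum
  simpa [ENNReal.toReal_ofReal (poisPMF_nonneg hν _)] using hsum

lemma poisPMF_mul_left {n : ℕ} (μ : Fin n → ℝ) (s : ℝ) (y : Fin n → ℕ) :
    poisPMF (fun i => s * μ i) y =
      Real.exp (-(s * ∑ i, μ i)) * ((∏ i, μ i ^ y i / (y i).factorial) * s ^ ∑ i, y i) := by
  rw [poisPMF, Finset.mul_sum, ← Finset.sum_neg_distrib, Real.exp_sum, ← Finset.prod_pow_eq_pow_sum,
    ← Finset.prod_mul_distrib, ← Finset.prod_mul_distrib]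
  refine Finset.prod_congr rfl fun i _ => ?_
  rw [mul_pow]
  ring

/-- The unnormalized joint weight of two independent `Pois(μ)` vectors. -/
def poisPairCoeff {n : ℕ} (μ : Fin n → ℝ) (yz : (Fin n → ℕ) × (Fin n → ℕ)) : ℝ :=
  (∏ i, μ i ^ yz.1 i / (yz.1 i).factorial) * ∏ i, μ i ^ yz.2 i / (yz.2 i).factorial

/-- The total count `⟨y + z, 1_n⟩` of a pair of count vectors. -/
def pairCount {n : ℕ} (yz : (Fin n → ℕ) × (Fin n → ℕ)) : ℕ := ∑ i, (yz.1 i + yz.2 i)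

lemma poisPMF_mul_poisPMF {n : ℕ} (μ : Fin n → ℝ) (s : ℝ) (yz : (Fin n → ℕ) × (Fin n → ℕ)) :
    poisPMF (fun i => s * μ i) yz.1 * poisPMF (fun i => s * μ i) yz.2 =
      tiltedWeight (poisPairCoeff μ) pairCount (2 * ∑ i, μ i) s yz := by
  rw [poisPMF_mul_left, poisPMF_mul_left, tiltedWeight, poisPairCoeff, pairCount,
    Finset.sum_add_distrib, pow_add, show -(s * (2 * ∑ i, μ i)) =
      -(s * ∑ i, μ i) + -(s * ∑ i, μ i) by ring, Real.exp_add]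
  ring

lemma hasSum_poisPairCoeff_mul_pow {n : ℕ} {μ : Fin n → ℝ} (hμ : ∀ i, 0 ≤ μ i) {s : ℝ}
    (hs : 0 ≤ s) :
    HasSum (fun yz => poisPairCoeff μ yz * s ^ pairCount yz) (Real.exp (s * (2 * ∑ i, μ i))) := by
  have hν : ∀ i, 0 ≤ s * μ i := fun i => mul_nonneg hs (hμ i)
  have h := hasSum_poisPMF hν
  have hprod := h.mul h
    (h.summable.mul_of_nonneg h.summable (poisPMF_nonneg hν) (poisPMF_nonneg hν))
  simp_rw [poisPMF_mul_poisPMF, tiltedWeight] at hprod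
  convert! hprod.mul_left (Real.exp (s * (2 * ∑ i, μ i))) using 1
  · ext yz
    rw [← mul_assoc, ← Real.exp_add, add_neg_cancel, Real.exp_zero, one_mul]
  · simp

lemma two_mul_sqrt_two_mul_one_sub_sqrt_le {p : ℝ} (hp : 0 ≤ p) (hp' : p ≤ 1 / 2) :
    2 * √2 * (1 - √(1 - p)) ≤ 5 * p / 3 := by
  have h2 : √2 ≤ 1.4143 := Real.sqrt_le_iff.2 (by norm_num)
  have hr : 0.7071 ≤ √(1 - p) := Real.le_sqrt_of_sq_le (by norm_num; linarith)
  have hsq : √(1 - p) ^ 2 = 1 - p := Real.sq_sqrt (by linarith)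
  have hle : √(1 - p) ≤ 1 := Real.sqrt_le_one.2 (by linarith)
  have hx : 1 - √(1 - p) ≤ p / 1.7071 := by
    rw [le_div_iff₀ (by norm_num)]
    nlinarith
  calc 2 * √2 * (1 - √(1 - p)) ≤ 2 * 1.4143 * (p / 1.7071) := by gcongr
    _ ≤ 5 * p / 3 := by
      ring_nf
      nlinarith

/-- bias bound: if the variance of the loss is decreasing in the shrinkage
parameter on `[0, 1/2]`, then for `p ∈ [0, 1/2]`,
`|Err_p(g) - Err(g)| ≤ (5p/3) √(Var[D_φ(Ỹ, g(Y))] Σ_i μ_i)`. -/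
theorem stmt17 {n : ℕ} (μ : Fin n → ℝ) (hμ : ∀ i, 0 ≤ μ i)
    (g : (Fin n → ℕ) → Fin n → ℝ)
    (φ : (Fin n → ℝ) → ℝ) (φ' : (Fin n → ℝ) → Fin n → ℝ)
    (hconv : ConvexOn ℝ Set.univ φ) (hgrad : HasGrad φ φ')
    (hsum1 : ∀ t ∈ Set.Icc (0 : ℝ) (1 / 2),
      Summable (fun yz : (Fin n → ℕ) × (Fin n → ℕ) =>
        poisPMF (fun i => (1 - t) * μ i) yz.1 * poisPMF (fun i => (1 - t) * μ i) yz.2 *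
          breg φ φ' (toR yz.2) (g yz.1)))
    (hsum2 : ∀ t ∈ Set.Icc (0 : ℝ) (1 / 2),
      Summable (fun yz : (Fin n → ℕ) × (Fin n → ℕ) =>
        poisPMF (fun i => (1 - t) * μ i) yz.1 * poisPMF (fun i => (1 - t) * μ i) yz.2 *
          breg φ φ' (toR yz.2) (g yz.1) * (∑ i, ((yz.1 i : ℝ) + (yz.2 i : ℝ)))))
    (hsum3 : ∀ t ∈ Set.Icc (0 : ℝ) (1 / 2),
      Summable (fun yz : (Fin n → ℕ) × (Fin n → ℕ) =>
        poisPMF (fun i => (1 - t) * μ i) yz.1 * poisPMF (fun i => (1 - t) * μ i) yz.2 *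
          (breg φ φ' (toR yz.2) (g yz.1)) ^ 2))
    (hmono : ∀ s t : ℝ, 0 ≤ s → s ≤ t → t ≤ 1 / 2 →
      sqFn μ g φ φ' t - (errFn μ g φ φ' t) ^ 2 ≤ sqFn μ g φ φ' s - (errFn μ g φ φ' s) ^ 2) :
    ∀ p : ℝ, 0 ≤ p → p ≤ 1 / 2 →
      |errFn μ g φ φ' p - errFn μ g φ φ' 0|
        ≤ 5 * p / 3 *
            Real.sqrt ((sqFn μ g φ φ' 0 - (errFn μ g φ φ' 0) ^ 2) * ∑ i, μ i) := by
  intro p hp hp'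
  have hcount : ∀ yz : (Fin n → ℕ) × (Fin n → ℕ),
      ∑ i, ((yz.1 i : ℝ) + (yz.2 i : ℝ)) = (pairCount yz : ℝ) := fun yz => by simp [pairCount]
  simp only [errFn, sqFn, poisPMF_mul_poisPMF, hcount] at hsum1 hsum2 hsum3 hmono ⊢
  have hmem : ∀ s ∈ Icc (1 - p) 1, 1 - s ∈ Icc (0 : ℝ) (1 / 2) := fun s hs =>
    ⟨by linarith [hs.2], by linarith [hs.1]⟩
  have hc : ∀ yz, 0 ≤ poisPairCoeff μ yz := fun yz =>
    mul_nonneg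
      (Finset.prod_nonneg fun i _ => div_nonneg (pow_nonneg (hμ i) _) (Nat.cast_nonneg _))
      (Finset.prod_nonneg fun i _ => div_nonneg (pow_nonneg (hμ i) _) (Nat.cast_nonneg _))
  have hL : 0 ≤ ∑ i, μ i := Finset.sum_nonneg fun i _ => hμ i
  have key := abs_tsum_tiltedWeight_sub_le (a := 1 - p)
    (f := fun yz : (Fin n → ℕ) × (Fin n → ℕ) => breg φ φ' (toR yz.2) (g yz.1)) hc
    (mul_nonneg zero_le_two hL) (fun s hs => hasSum_poisPairCoeff_mul_pow hμ hs)
    (by linarith) (by linarith)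
    (fun s hs => by simpa only [sub_sub_cancel] using hsum1 (1 - s) (hmem s hs))
    (fun s hs => by simpa only [sub_sub_cancel] using hsum2 (1 - s) (hmem s hs))
    (fun s hs => by simpa only [sub_sub_cancel] using hsum3 (1 - s) (hmem s hs))
    (fun s hs => by
      simpa only [sub_sub_cancel] using hmono 0 (1 - s) le_rfl (hmem s hs).1 (hmem s hs).2)
  rw [sub_zero] at key ⊢
  refine key.trans ?_
  rw [mul_left_comm _ 2, Real.sqrt_mul zero_le_two]
  linarith [mul_le_mul_of_nonneg_right (two_mul_sqrt_two_mul_one_sub_sqrt_le hp hp')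
    (Real.sqrt_nonneg (((∑' yz, tiltedWeight (poisPairCoeff μ) pairCount (2 * ∑ i, μ i) 1 yz *
      breg φ φ' (toR yz.2) (g yz.1) ^ 2) -
      (∑' yz, tiltedWeight (poisPairCoeff μ) pairCount (2 * ∑ i, μ i) 1 yz *
        breg φ φ' (toR yz.2) (g yz.1)) ^ 2) * ∑ i, μ i))]
end
end
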